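/- Let (A, m_k, Q) be a 4-cyclic A∞-algebra over ℝ of finite type (m_k = 0 for all k > N), such that Q restricted to A^2 is anisotropic (Q(v, v) = 0 implies v = 0 for v ∈ A^2), and suppose there exists b_0 ∈ A^1 with κ(b_0) = 0. Then for every b ∈ A^1 the twisted Kuranishi map vanishes identically: κ^b(x) = 0 for all x ∈ A^1. -/

import Mathlib

/-- A (curved) A∞-algebra structure on a ℤ-graded `K`-vector space `V`:
graded pieces `grading p` (with `V` their direct sum), multilinear operations
`m k` of degree `2 - k` satisfying the A∞-relations (with Koszul signs) on
homogeneous elements `x j ∈ grading (d j)`.  The inner sum over `i` encodes the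
insertion of `m (k+1-k1) (x_i, …, x_{i+k2-1})` at (0-indexed) position `i`
among the `k1` arguments of `m k1`. -/
structure AInftyAlgebra (K V : Type) [Field K] [AddCommGroup V] [Module K V] where
  grading : ℤ → Submodule K V
  decomposition : DirectSum.Decomposition grading
  m : (k : ℕ) → MultilinearMap K (fun _ : Fin k => V) V
  m_degree : ∀ (k : ℕ) (d : ℕ → ℤ) (x : ℕ → V),
    (∀ j, x j ∈ grading (d j)) →
    m k (fun j : Fin k => x j) ∈ grading (2 - (k : ℤ) + ∑ j ∈ Finset.range k, d j)
  ainfty_rel : ∀ (k : ℕ) (d : ℕ → ℤ) (x : ℕ → V),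
    (∀ j, x j ∈ grading (d j)) →
    ∑ k1 ∈ Finset.range (k + 2), ∑ i ∈ Finset.range k1,
      ((-1 : K) ^ ((∑ j ∈ Finset.range i, d j) + (i : ℤ))) •
        m k1 (fun j : Fin k1 =>
          if (j : ℕ) < i then x j
          else if (j : ℕ) = i then
            m (k + 1 - k1) (fun l : Fin (k + 1 - k1) => x (i + (l : ℕ)))
          else x ((j : ℕ) + (k + 1 - k1) - 1)) = 0

/-- An `n`-cyclic A∞-algebra: a finite-dimensional A∞-algebra together with a
bilinear pairing `Q` concentrated in total degree `n`, graded-antisymmetric and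
cyclically invariant with respect to the operations `m k` (on homogeneous
elements `x 0, …, x k` of degrees `d 0, …, d k`). -/
structure CyclicAInftyAlgebra (K V : Type) [Field K] [AddCommGroup V] [Module K V]
    (n : ℤ) extends AInftyAlgebra K V where
  finiteDimensional : FiniteDimensional K V
  Q : V →ₗ[K] V →ₗ[K] K
  Q_graded : ∀ (p q : ℤ), p + q ≠ n → ∀ x ∈ grading p, ∀ y ∈ grading q, Q x y = 0
  Q_antisymm : ∀ (p q : ℤ) (x y : V), x ∈ grading p → y ∈ grading q →
    Q x y = ((-1 : K) ^ ((p + 1) * (q + 1) + 1)) * Q y x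
  Q_cyclic : ∀ (k : ℕ) (d : ℕ → ℤ) (x : ℕ → V), (∀ j, x j ∈ grading (d j)) →
    Q (m k (fun j : Fin k => x ((j : ℕ) + 1))) (x 0) =
      ((-1 : K) ^ ((d 0 + 1) * ((∑ j ∈ Finset.range k, d (j + 1)) + (k : ℤ)))) *
        Q (m k (fun j : Fin k => x (j : ℕ))) (x k)

/-- The Kuranishi map of an A∞-algebra of finite type (`m k = 0` for `k > N`):
`κ(x) = ∑_{k=0}^{N} m_k(x, …, x)`. -/
def kuranishi {K V : Type} [Field K] [AddCommGroup V] [Module K V]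
    (A : AInftyAlgebra K V) (N : ℕ) (x : V) : V :=
  ∑ k ∈ Finset.range (N + 1), A.m k (fun _ => x)

open scoped Classical in
/-- The sequence `b,…,b, x 0, b,…,b, x 1, …, x (k-1), b,…,b` with `l i` copies of `b`
in the `i`-th block: position `p` carries `x i` when `p = i + l 0 + ⋯ + l i`, else `b`. -/
noncomputable def interleave {V : Type} (b : V) (x : ℕ → V) (l : ℕ → ℕ) (k : ℕ)
    (p : ℕ) : V :=
  if h : ∃ i, i < k ∧ p = i + ∑ j ∈ Finset.range (i + 1), l j then x (Nat.find h) else b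

/-- The `b`-twisted operations `m_k^b(x_1,…,x_k) = Σ_{l_0,…,l_k ≥ 0}
m_{k+l_0+⋯+l_k}(b,…,b,x_1,b,…,b,…,x_k,b,…,b)` of an A∞-algebra of finite type
(`m j = 0` for `j > N`, so summing over total number of inserted `b`'s `L ≤ N`
captures the full — a priori infinite — sum). -/
noncomputable def twistedM {K V : Type} [Field K] [AddCommGroup V] [Module K V]
    (A : AInftyAlgebra K V) (N : ℕ) (b : V) (k : ℕ) (x : ℕ → V) : V :=
  ∑ L ∈ Finset.range (N + 1), ∑ l ∈ Finset.Nat.antidiagonalTuple (k + 1) L,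
    A.m (k + L) (fun j : Fin (k + L) =>
      interleave b x (fun i => if h : i < k + 1 then l ⟨i, h⟩ else 0) k j)

/-- The twisted Kuranishi map `κ^b(x) = ∑_k m_k^b(x, …, x)`. -/
noncomputable def twistedKuranishi {K V : Type} [Field K] [AddCommGroup V] [Module K V]
    (A : AInftyAlgebra K V) (N : ℕ) (b x : V) : V :=
  ∑ k ∈ Finset.range (N + 1), twistedM A N b k (fun _ => x)

open Finset in
theorem sum_range_mul_range_eq_sum_diag {M : Type*} [AddCommMonoid M] (N : ℕ) (f : ℕ → ℕ → M)
    (hf₁ : ∀ a b, N < a → f a b = 0) (hf₂ : ∀ a b, N < b → f a b = 0) :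
    ∑ a ∈ range (N + 1), ∑ b ∈ range (N + 1), f a b =
      ∑ n ∈ range (2 * N + 1), ∑ a ∈ range (n + 1), f a (n - a) := by
  rw [sum_range_diag_flip]
  trans ∑ a ∈ range (N + 1), ∑ b ∈ range (2 * N + 1 - a), f a b
  · refine sum_congr rfl fun a ha => sum_subset ?_ ?_
    · intro b hb
      simp only [mem_range] at *
      omega
    · intro b _ hb
      exact hf₂ a b (by simpa using hb)
  · refine sum_subset ?_ ?_
    · intro b hb
      simp only [mem_range] at *
      omega
    · intro a _ ha
      exact sum_eq_zero fun b _ => hf₁ a b (by simpa using ha)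

/-- The extension by zero of a tuple of natural numbers. -/
def tupleExtend {k : ℕ} (l : Fin (k + 1) → ℕ) (i : ℕ) : ℕ :=
  if h : i < k + 1 then l ⟨i, h⟩ else 0

/-- The position of the `i`-th letter in a word with blocks of lengths `g 0, g 1, …`
inserted around the letters. -/
def letterPos (g : ℕ → ℕ) (i : ℕ) : ℕ :=
  i + ∑ j ∈ Finset.range (i + 1), g j

theorem letterPos_strictMono (g : ℕ → ℕ) : StrictMono (letterPos g) := by
  refine strictMono_nat_of_lt_succ fun i => ?_
  simp only [letterPos, Finset.sum_range_succ _ (i + 1)]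
  omega

theorem sum_range_tupleExtend {k : ℕ} (l : Fin (k + 1) → ℕ) :
    ∑ j ∈ Finset.range (k + 1), tupleExtend l j = ∑ i, l i := by
  rw [← Fin.sum_univ_eq_sum_range]
  exact Finset.sum_congr rfl fun i _ => dif_pos i.2

theorem letterPos_tupleExtend_lt {k L : ℕ} {l : Fin (k + 1) → ℕ} (hl : ∑ i, l i = L) {i : ℕ}
    (hi : i < k) : letterPos (tupleExtend l) i < k + L := by
  have h : ∑ j ∈ Finset.range (i + 1), tupleExtend l j ≤
      ∑ j ∈ Finset.range (k + 1), tupleExtend l j :=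
    Finset.sum_le_sum_of_subset (Finset.range_subset_range.2 (by omega))
  rw [sum_range_tupleExtend, hl] at h
  simp only [letterPos]
  omega

open scoped Classical in
/-- The set of positions of the `k` letters in a word of length `n`. -/
noncomputable def letterSet {k : ℕ} (n : ℕ) (l : Fin (k + 1) → ℕ) : Finset (Fin n) :=
  Finset.univ.filter fun p => ∃ i, i < k ∧ (p : ℕ) = letterPos (tupleExtend l) i

theorem mem_letterSet {k n : ℕ} {l : Fin (k + 1) → ℕ} {p : Fin n} :
    p ∈ letterSet n l ↔ ∃ i, i < k ∧ (p : ℕ) = letterPos (tupleExtend l) i := by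
  simp [letterSet]

theorem card_letterSet {k L : ℕ} {l : Fin (k + 1) → ℕ} (hl : ∑ i, l i = L) :
    (letterSet (k + L) l).card = k := by
  have h : letterSet (k + L) l = Finset.univ.image
      fun i : Fin k => (⟨letterPos (tupleExtend l) i, letterPos_tupleExtend_lt hl i.2⟩ :
        Fin (k + L)) := by
    ext p
    simp only [mem_letterSet, Finset.mem_image, Finset.mem_univ, true_and, Fin.ext_iff]
    constructor
    · rintro ⟨i, hi, h⟩
      exact ⟨⟨i, hi⟩, h.symm⟩
    · rintro ⟨i, h⟩
      exact ⟨i, i.2, h.symm⟩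
  rw [h, Finset.card_image_of_injective, Finset.card_univ, Fintype.card_fin]
  intro i j hij
  exact Fin.ext ((letterPos_strictMono _).injective (Fin.ext_iff.1 hij))

theorem letterSet_injOn {k L : ℕ} {l l' : Fin (k + 1) → ℕ} (hl : ∑ i, l i = L)
    (hl' : ∑ i, l' i = L) (h : letterSet (k + L) l = letterSet (k + L) l') : l = l' := by
  have hpos : (fun i : Fin k => letterPos (tupleExtend l) i) =
      fun i : Fin k => letterPos (tupleExtend l') i := by
    refine (StrictMono.range_inj ((letterPos_strictMono _).comp Fin.val_strictMono)
      ((letterPos_strictMono _).comp Fin.val_strictMono)).1 ?_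
    ext p
    simp only [Set.mem_range, Function.comp_apply]
    constructor
    · rintro ⟨i, rfl⟩
      obtain ⟨j, hj, hij⟩ := mem_letterSet.1 (h ▸ mem_letterSet.2 ⟨i, i.2, rfl⟩ :
        (⟨letterPos (tupleExtend l) i, letterPos_tupleExtend_lt hl i.2⟩ : Fin (k + L)) ∈
          letterSet (k + L) l')
      exact ⟨⟨j, hj⟩, hij.symm⟩
    · rintro ⟨i, rfl⟩
      obtain ⟨j, hj, hij⟩ := mem_letterSet.1 (h ▸ mem_letterSet.2 ⟨i, i.2, rfl⟩ :
        (⟨letterPos (tupleExtend l') i, letterPos_tupleExtend_lt hl' i.2⟩ : Fin (k + L)) ∈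
          letterSet (k + L) l)
      exact ⟨⟨j, hj⟩, hij.symm⟩
  have hsum : ∀ i ≤ k + 1, ∑ j ∈ Finset.range i, tupleExtend l j =
      ∑ j ∈ Finset.range i, tupleExtend l' j := by
    intro i hi
    rcases i with _ | i
    · simp
    · rcases Nat.lt_or_ge i k with hik | hik
      · simpa [letterPos] using congrFun hpos ⟨i, hik⟩
      · obtain rfl : i = k := by omega
        rw [sum_range_tupleExtend, sum_range_tupleExtend, hl, hl']
  ext i
  have h₁ := hsum i (by omega)
  have h₂ := hsum (i + 1) (by omega)
  rw [Finset.sum_range_succ, Finset.sum_range_succ, h₁] at h₂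
  simpa [tupleExtend, Nat.lt_succ_iff.1 i.2] using h₂

theorem exists_letterSet_eq {k L : ℕ} (S : Finset (Fin (k + L))) (hS : S.card = k) :
    ∃ l : Fin (k + 1) → ℕ, ∑ i, l i = L ∧ letterSet (k + L) l = S := by
  let e := S.orderEmbOfFin hS
  let E : ℕ → ℕ := fun i => if h : i < k then e ⟨i, h⟩ else k + L
  have hEe : ∀ i : Fin k, E i = e i := fun i => by simp [E]
  have hEk : E k = k + L := by simp [E]
  have hE : ∀ i < k, E i < E (i + 1) := by
    intro i hi
    rcases Nat.lt_or_ge (i + 1) k with h | h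
    · simp only [E, hi, h, dif_pos]
      exact e.strictMono (by simp [Fin.lt_def])
    · simp only [E, hi, dif_pos, not_lt.2 h, dif_neg, not_false_eq_true]
      exact (e ⟨i, hi⟩).2
  have hle : ∀ i ≤ k, i ≤ E i := by
    intro i
    induction i with
    | zero => simp
    | succ i ih =>
      intro hi
      have := hE i (by omega)
      have := ih (by omega)
      omega
  let g : ℕ → ℕ := fun i => Nat.casesOn i (E 0) fun j => E (j + 1) - (E j + 1)
  have hg : ∀ i ≤ k, ∑ j ∈ Finset.range (i + 1), tupleExtend (fun i : Fin (k + 1) => g i) j =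
      E i - i := by
    intro i
    induction i with
    | zero => simp [tupleExtend, g]
    | succ i ih =>
      intro hi
      rw [Finset.sum_range_succ, ih (by omega)]
      have h₁ := hE i (by omega)
      have h₂ := hle i (by omega)
      have h₃ : i + 1 < k + 1 := by omega
      simp only [tupleExtend, h₃, dif_pos, g]
      omega
  refine ⟨fun i => g i, ?_, ?_⟩
  · rw [← sum_range_tupleExtend, hg k le_rfl, hEk]
    omega
  · have hmem : ∀ p, p ∈ S ↔ ∃ i, e i = p := fun p => by
      rw [← Finset.mem_coe, ← Finset.range_orderEmbOfFin S hS, Set.mem_range]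
    ext p
    rw [mem_letterSet, hmem]
    constructor
    · rintro ⟨i, hi, hp⟩
      refine ⟨⟨i, hi⟩, Fin.ext ?_⟩
      rw [hp, letterPos, hg i hi.le, ← hEe]
      have := hle i hi.le
      simp only
      omega
    · rintro ⟨i, rfl⟩
      refine ⟨i, i.2, ?_⟩
      rw [letterPos, hg i i.2.le, ← hEe]
      have := hle i i.2.le
      omega

theorem sum_antidiagonalTuple_letterSet {M : Type*} [AddCommMonoid M] (k L : ℕ)
    (f : Finset (Fin (k + L)) → M) :
    ∑ l ∈ Finset.Nat.antidiagonalTuple (k + 1) L, f (letterSet (k + L) l) =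
      ∑ S ∈ Finset.powersetCard k Finset.univ, f S := by
  refine Finset.sum_bij (fun l _ => letterSet (k + L) l) ?_ ?_ ?_ fun _ _ => rfl
  · intro l hl
    exact Finset.mem_powersetCard_univ.2 (card_letterSet (Finset.Nat.mem_antidiagonalTuple.1 hl))
  · intro l hl l' hl' h
    exact letterSet_injOn (Finset.Nat.mem_antidiagonalTuple.1 hl)
      (Finset.Nat.mem_antidiagonalTuple.1 hl') h
  · intro S hS
    obtain ⟨l, hl, hlS⟩ := exists_letterSet_eq S (Finset.mem_powersetCard_univ.1 hS)
    exact ⟨l, Finset.Nat.mem_antidiagonalTuple.2 hl, hlS⟩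

section Algebra

variable {K V : Type} [Field K] [AddCommGroup V] [Module K V]

theorem twistedM_const (A : AInftyAlgebra K V) (N : ℕ) (b x : V) (k : ℕ) :
    twistedM A N b k (fun _ => x) = ∑ L ∈ Finset.range (N + 1),
      ∑ S ∈ Finset.powersetCard k (Finset.univ : Finset (Fin (k + L))),
        A.m (k + L) (S.piecewise (fun _ => x) fun _ => b) := by
  refine Finset.sum_congr rfl fun L _ => ?_
  rw [← sum_antidiagonalTuple_letterSet]
  refine Finset.sum_congr rfl fun l _ => ?_
  congr 1
  ext p
  by_cases h : p ∈ letterSet (k + L) l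
  · rw [Finset.piecewise_eq_of_mem _ _ _ h]
    exact dif_pos (mem_letterSet.1 h)
  · rw [Finset.piecewise_eq_of_notMem _ _ _ h]
    exact dif_neg fun h' => h (mem_letterSet.2 h')

theorem twistedKuranishi_eq_kuranishi_add (A : AInftyAlgebra K V) (N : ℕ)
    (hN : ∀ k, N < k → A.m k = 0) (b x : V) :
    twistedKuranishi A N b x = kuranishi A N (x + b) := by
  have hexpand : ∀ n, A.m n (fun _ => x + b) = ∑ k ∈ Finset.range (n + 1),
      ∑ S ∈ Finset.powersetCard k (Finset.univ : Finset (Fin n)),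
        A.m n (S.piecewise (fun _ => x) fun _ => b) := by
    intro n
    have h := (A.m n).map_add_univ (fun _ => x) fun _ => b
    rw [← Finset.powerset_univ, Finset.sum_powerset, Finset.card_univ, Fintype.card_fin] at h
    exact h
  simp only [twistedKuranishi, twistedM_const]
  rw [sum_range_mul_range_eq_sum_diag]
  · have hdiag : ∀ n, ∑ k ∈ Finset.range (n + 1),
        ∑ S ∈ Finset.powersetCard k (Finset.univ : Finset (Fin (k + (n - k)))),
          A.m (k + (n - k)) (S.piecewise (fun _ => x) fun _ => b) =
        A.m n fun _ => x + b := by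
      intro n
      rw [hexpand]
      refine Finset.sum_congr rfl fun k hk => ?_
      rw [Nat.add_sub_of_le (Nat.lt_succ_iff.1 (Finset.mem_range.1 hk))]
    simp only [hdiag]
    refine (Finset.sum_subset (Finset.range_subset_range.2 (by omega)) fun n _ hn => ?_).symm
    rw [hN n (by simpa using hn), zero_apply]
  · intro k L h
    simp [hN (k + L) (by omega)]
  · intro k L h
    simp [hN (k + L) (by omega)]

theorem m_const_mem (A : AInftyAlgebra K V) {x : V} (hx : x ∈ A.grading 1) (k : ℕ) :
    A.m k (fun _ => x) ∈ A.grading 2 := by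
  simpa using A.m_degree k (fun _ => 1) (fun _ => x) fun _ => hx

theorem kuranishi_mem (A : AInftyAlgebra K V) (N : ℕ) {x : V} (hx : x ∈ A.grading 1) :
    kuranishi A N x ∈ A.grading 2 :=
  Submodule.sum_mem _ fun k _ => m_const_mem A hx k

theorem m_update_mem (A : AInftyAlgebra K V) {x y : V} (hx : x ∈ A.grading 1)
    (hy : y ∈ A.grading 1) (k : ℕ) (i : Fin k) :
    A.m k (Function.update (fun _ => x) i y) ∈ A.grading 2 := by
  have h := A.m_degree k (fun _ => 1) (fun j => if j = i then y else x) fun j => by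
    split_ifs <;> assumption
  have he : Function.update (fun _ => x) i y = fun j : Fin k => if (j : ℕ) = i then y else x := by
    ext j
    simp [Function.update_apply, Fin.ext_iff]
  rw [he]
  simpa using h

/-- The derivative of the Kuranishi map at `x` in direction `y`. -/
def kuranishiDeriv (A : AInftyAlgebra K V) (N : ℕ) (x y : V) : V :=
  ∑ k ∈ Finset.range (N + 1), ∑ i : Fin k, A.m k (Function.update (fun _ => x) i y)

theorem kuranishiDeriv_mem (A : AInftyAlgebra K V) (N : ℕ) {x y : V} (hx : x ∈ A.grading 1)
    (hy : y ∈ A.grading 1) : kuranishiDeriv A N x y ∈ A.grading 2 :=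
  Submodule.sum_mem _ fun k _ => Submodule.sum_mem _ fun i _ => m_update_mem A hx hy k i

theorem kuranishiDeriv_kuranishi (A : AInftyAlgebra K V) (N : ℕ) (hN : ∀ k, N < k → A.m k = 0)
    {x : V} (hx : x ∈ A.grading 1) : kuranishiDeriv A N x (kuranishi A N x) = 0 := by
  have hrel : ∀ n, ∑ k ∈ Finset.range (n + 2), ∑ i : Fin k,
      A.m k (Function.update (fun _ => x) i (A.m (n + 1 - k) fun _ => x)) = 0 := by
    intro n
    rw [← A.ainfty_rel n (fun _ => 1) (fun _ => x) fun _ => hx]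
    refine Finset.sum_congr rfl fun k _ => ?_
    rw [← Fin.sum_univ_eq_sum_range (fun i => ((-1 : K) ^ ((∑ j ∈ Finset.range i, (1 : ℤ)) +
      (i : ℤ))) • A.m k (fun j : Fin k => if (j : ℕ) < i then x else if (j : ℕ) = i then
        A.m (n + 1 - k) (fun _ => x) else x))]
    refine Finset.sum_congr rfl fun i _ => ?_
    have hsign : ((-1 : K) ^ ((∑ j ∈ Finset.range (i : ℕ), (1 : ℤ)) + ((i : ℕ) : ℤ))) = 1 :=
      Even.neg_one_zpow (by simp)
    rw [hsign, one_smul]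
    congr 1
    ext j
    rcases lt_trichotomy (j : ℕ) i with h | h | h
    · simp [Fin.ext_iff, h, h.ne]
    · simp [Function.update_apply, Fin.ext_iff, h]
    · simp [Fin.ext_iff, h.ne']
  simp only [kuranishiDeriv, kuranishi, MultilinearMap.map_update_sum]
  have hcomm : ∀ k, ∑ i : Fin k, ∑ n ∈ Finset.range (N + 1),
      A.m k (Function.update (fun _ => x) i (A.m n fun _ => x)) =
      ∑ n ∈ Finset.range (N + 1), ∑ i : Fin k,
        A.m k (Function.update (fun _ => x) i (A.m n fun _ => x)) :=
    fun k => Finset.sum_comm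
  simp only [hcomm]
  rw [sum_range_mul_range_eq_sum_diag]
  · refine Finset.sum_eq_zero fun n _ => ?_
    rcases n with _ | n
    · simp
    · exact hrel n
  · intro k n h
    simp [hN k h]
  · intro k n h
    simp [hN n h, MultilinearMap.map_update_zero]

theorem Q_m_update_rotate {n : ℤ} (A : CyclicAInftyAlgebra K V n) {x y z : V}
    (hx : x ∈ A.grading 1) (hy : y ∈ A.grading 1) (hz : z ∈ A.grading 2) (k : ℕ) (i : Fin k) :
    A.Q (A.m k (Function.update (fun _ => x) i y)) z =
      A.Q (A.m k (Function.update (fun _ => x) i.rev z)) y := by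
  let u : ℕ → V := fun j =>
    if j % (k + 1) = 0 then z else if j % (k + 1) = i + 1 then y else x
  let d : ℕ → ℤ := fun j => if j % (k + 1) = 0 then 2 else 1
  have hud : ∀ j, u j ∈ A.grading (d j) := by
    intro j
    simp only [u, d]
    split_ifs <;> assumption
  have hrot : ∀ s ≤ (i : ℕ) + 1,
      A.Q (A.m k fun j : Fin k => u (s + 1 + j)) (u s) = A.Q (A.m k fun j : Fin k => u (1 + j))
        (u 0) := by
    intro s
    induction s with
    | zero => simp
    | succ s ih =>
      intro hs
      rw [← ih (by omega)]
      have h := A.Q_cyclic k (fun j => d (s + 1 + j)) (fun j => u (s + 1 + j)) fun j => hud _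
      have hd : d (s + 1) = 1 := if_neg (by rw [Nat.mod_eq_of_lt (by omega)]; omega)
      have hu : u (s + 1 + k) = u s := by
        simp only [u, add_assoc, add_comm 1 k, Nat.add_mod_right]
      have hsign : ((-1 : K) ^ ((d (s + 1 + 0) + 1) *
          ((∑ j ∈ Finset.range k, d (s + 1 + (j + 1))) + (k : ℤ)))) = 1 := by
        refine Even.neg_one_zpow (Even.mul_right ?_ _)
        rw [add_zero, hd]
        decide
      rw [hsign, one_mul, hu, add_zero] at h
      rw [← h]
      congr 3
      ext j
      congr 1
      omega
  have h := hrot (i + 1) le_rfl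
  have hu0 : u 0 = z := by simp [u]
  have hui : u (i + 1) = y := by
    have : ((i : ℕ) + 1) % (k + 1) = i + 1 := Nat.mod_eq_of_lt (by omega)
    simp [u, this]
  rw [hu0, hui] at h
  have h₁ : (fun j : Fin k => u (1 + j)) = Function.update (fun _ => x) i y := by
    ext j
    have : (1 + (j : ℕ)) % (k + 1) = j + 1 := by rw [Nat.mod_eq_of_lt (by omega)]; omega
    simp [u, this, Function.update_apply, Fin.ext_iff]
  have h₂ : (fun j : Fin k => u (i + 1 + 1 + j)) = Function.update (fun _ => x) i.rev z := by
    ext j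
    have hmod : ((i : ℕ) + 1 + 1 + j) % (k + 1) =
        if (i : ℕ) + 1 + 1 + j < k + 1 then (i : ℕ) + 1 + 1 + j
          else (i : ℕ) + 1 + 1 + j - (k + 1) := by
      split_ifs with hlt
      · exact Nat.mod_eq_of_lt hlt
      · rw [Nat.mod_eq_sub_mod (by omega), Nat.mod_eq_of_lt (by omega)]
    simp only [u, hmod, Function.update_apply, Fin.ext_iff, Fin.val_rev]
    have := i.2
    have := j.2
    split_ifs <;> first | rfl | omega
  rw [← h₁, ← h₂, h]

theorem Q_kuranishiDeriv {n : ℤ} (A : CyclicAInftyAlgebra K V n) (N : ℕ) {x y z : V}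
    (hx : x ∈ A.grading 1) (hy : y ∈ A.grading 1) (hz : z ∈ A.grading 2) :
    A.Q (kuranishiDeriv A.toAInftyAlgebra N x y) z =
      A.Q (kuranishiDeriv A.toAInftyAlgebra N x z) y := by
  simp only [kuranishiDeriv, map_sum, LinearMap.sum_apply, Q_m_update_rotate A hx hy hz]
  exact Finset.sum_congr rfl fun k _ => Equiv.sum_comp Fin.revPerm
    fun i => A.Q (A.m k (Function.update (fun _ => x) i z)) y

end Algebra

section Analysis

variable {V : Type} [AddCommGroup V] [Module ℝ V]

theorem MultilinearMap.hasDerivAt_line {W : Type*} [NormedAddCommGroup W] [NormedSpace ℝ W]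
    {k : ℕ} (f : MultilinearMap ℝ (fun _ : Fin k => V) W) (c y : V) (t : ℝ) :
    HasDerivAt (fun s : ℝ => f fun _ => c + s • y)
      (∑ i, f (Function.update (fun _ => c + t • y) i y)) t := by
  induction k with
  | zero =>
    have h : (fun s : ℝ => f fun _ => c + s • y) = fun _ => f 0 := by
      ext s
      congr 1
      exact Subsingleton.elim _ _
    rw [h]
    simpa using hasDerivAt_const t (f 0)
  | succ k ih =>
    have hcons : ∀ v : V, (fun _ : Fin (k + 1) => v) = Fin.cons v fun _ => v := fun v => by
      ext i
      refine Fin.cases ?_ (fun j => ?_) i <;> simp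
    have hfun : (fun s : ℝ => f fun _ => c + s • y) = fun s : ℝ =>
        f.curryLeft c (fun _ => c + s • y) + s • f.curryLeft y (fun _ => c + s • y) := by
      ext s
      rw [hcons, ← f.curryLeft_apply, map_add, map_smul]
      rfl
    rw [hfun]
    refine ((ih (f.curryLeft c)).add ((hasDerivAt_id t).smul (ih (f.curryLeft y)))).congr_deriv ?_
    have h₀ : f (Function.update (fun _ => c + t • y) 0 y) =
        f.curryLeft y fun _ => c + t • y := by
      rw [hcons, Fin.update_cons_zero, f.curryLeft_apply]
    have h₁ : ∀ i : Fin k, f (Function.update (fun _ => c + t • y) i.succ y) =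
        f.curryLeft c (Function.update (fun _ => c + t • y) i y) +
          t • f.curryLeft y (Function.update (fun _ => c + t • y) i y) := by
      intro i
      rw [hcons, ← Fin.cons_update, ← f.curryLeft_apply, map_add, map_smul]
      rfl
    rw [Fin.sum_univ_succ, h₀]
    simp only [h₁, Finset.sum_add_distrib, Finset.smul_sum, id_eq, one_smul]
    abel

theorem bilin_self_eq_of_deriv_eq_zero [FiniteDimensional ℝ V] (A : AInftyAlgebra ℝ V)
    (N : ℕ) (B : V →ₗ[ℝ] V →ₗ[ℝ] ℝ) (c y : V)
    (h : ∀ t : ℝ, B (kuranishiDeriv A N (c + t • y) y) (kuranishi A N (c + t • y)) +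
      B (kuranishi A N (c + t • y)) (kuranishiDeriv A N (c + t • y) y) = 0) :
    B (kuranishi A N (c + y)) (kuranishi A N (c + y)) =
      B (kuranishi A N c) (kuranishi A N c) := by
  let e := (Module.finBasis ℝ V).equivFun
  let : NormedAddCommGroup V := NormedAddCommGroup.induced V _ e e.injective
  let : NormedSpace ℝ V := NormedSpace.induced ℝ V _ e
  let B' : V →L[ℝ] V →L[ℝ] ℝ :=
    LinearMap.toContinuousLinearMap (LinearMap.toContinuousLinearMap.toLinearMap ∘ₗ B)
  have hκ : ∀ t : ℝ, HasDerivAt (fun s : ℝ => kuranishi A N (c + s • y))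
      (kuranishiDeriv A N (c + t • y) y) t := fun t =>
    HasDerivAt.fun_sum fun k _ => (A.m k).hasDerivAt_line c y t
  have hB : ∀ t : ℝ, HasDerivAt
      (fun s : ℝ => B' (kuranishi A N (c + s • y)) (kuranishi A N (c + s • y))) 0 t := by
    intro t
    rw [← h t]
    exact (B'.hasFDerivAt.comp_hasDerivAt t (hκ t)).clm_apply (hκ t)
  have hconst := is_const_of_deriv_eq_zero (fun t => (hB t).differentiableAt)
    (fun t => (hB t).deriv) 1 0
  simp only [one_smul, zero_smul, add_zero] at hconst
  exact hconst

end Analysis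

/-- For a `4`-cyclic A∞-algebra over `ℝ` of finite type whose pairing is
anisotropic on the degree-2 part, if some `b₀ ∈ A^1` satisfies `κ(b₀) = 0`,
then for every `b ∈ A^1` the twisted Kuranishi map `κ^b` vanishes identically
on `A^1`. -/
theorem twistedKuranishi_eq_zero_of_exists_MC {V : Type} [AddCommGroup V]
    [Module ℝ V] (A : CyclicAInftyAlgebra ℝ V 4) (N : ℕ)
    (hN : ∀ k, N < k → A.m k = 0)
    (haniso : ∀ v ∈ A.grading 2, A.Q v v = 0 → v = 0)
    (hex : ∃ b₀ ∈ A.grading 1, kuranishi A.toAInftyAlgebra N b₀ = 0) :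
    ∀ b ∈ A.grading 1, ∀ x ∈ A.grading 1,
      twistedKuranishi A.toAInftyAlgebra N b x = 0 := by
  obtain ⟨b₀, hb₀, hκ₀⟩ := hex
  intro b hb x hx
  rw [twistedKuranishi_eq_kuranishi_add _ N hN]
  have hc : x + b ∈ A.grading 1 := Submodule.add_mem _ hx hb
  have hy : x + b - b₀ ∈ A.grading 1 := Submodule.sub_mem _ hc hb₀
  have := A.finiteDimensional
  refine haniso _ (kuranishi_mem _ N hc) ?_
  have h := bilin_self_eq_of_deriv_eq_zero A.toAInftyAlgebra N A.Q b₀ (x + b - b₀) fun t => by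
    have ht : b₀ + t • (x + b - b₀) ∈ A.grading 1 :=
      Submodule.add_mem _ hb₀ (Submodule.smul_mem _ _ hy)
    have hκ := kuranishi_mem A.toAInftyAlgebra N ht
    have hzero : A.Q (kuranishiDeriv A.toAInftyAlgebra N (b₀ + t • (x + b - b₀)) (x + b - b₀))
        (kuranishi A.toAInftyAlgebra N (b₀ + t • (x + b - b₀))) = 0 := by
      rw [Q_kuranishiDeriv A N ht hy hκ, kuranishiDeriv_kuranishi _ N hN ht, map_zero,
        LinearMap.zero_apply]
    rw [A.Q_antisymm 2 2 _ _ hκ (kuranishiDeriv_mem _ N ht hy), hzero, mul_zero, add_zero]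
  rwa [add_sub_cancel, hκ₀, map_zero] at h
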